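/- The integral ∫_0^1 (1/x + 1/log(1−x)) dx converges and equals the Euler–Mascheroni constant γ. (The integrand, defined for 0 < x < 1, extends continuously to [0,1] with value 1/2 at x = 0 and value 1 at x = 1.) -/

import Mathlib

open MeasureTheory

open Set Filter Topology

lemma one_div_one_sub_add_one_div_log_mem_Icc {y : ℝ} (hy : y ∈ Ioc (0 : ℝ) 1) :
    1 / (1 - y) + 1 / Real.log y ∈ Icc (0 : ℝ) 1 := by
  obtain ⟨h0, h1⟩ := hy
  rcases h1.eq_or_lt with rfl | h1
  · simp
  have hlog : Real.log y < 0 := Real.log_neg h0 h1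
  have hup : Real.log y ≤ y - 1 := Real.log_le_sub_one_of_pos h0
  have hlow : 1 - y⁻¹ ≤ Real.log y := Real.one_sub_inv_le_log_of_pos h0
  have hlow' : y - 1 ≤ y * Real.log y := by
    have := mul_le_mul_of_nonneg_left hlow h0.le
    rwa [mul_sub, mul_one, mul_inv_cancel₀ h0.ne'] at this
  have hpos : 0 < (1 - y) * -Real.log y := mul_pos (by linarith) (by linarith)
  have heq : 1 / (1 - y) + 1 / Real.log y
      = (-Real.log y - (1 - y)) / ((1 - y) * -Real.log y) := by
    have := hlog.ne
    have : 1 - y ≠ 0 := by linarith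
    field_simp
    ring
  rw [heq]
  constructor
  · exact div_nonneg (by linarith) hpos.le
  · rw [div_le_one hpos]
    linarith

lemma integral_const_rpow_eq {y : ℝ} (h0 : 0 < y) (h1 : y ≠ 1) (b : ℝ) :
    ∫ s in (0 : ℝ)..b, y ^ s = (y ^ b - 1) / Real.log y := by
  have hlog : Real.log y ≠ 0 := Real.log_ne_zero_of_pos_of_ne_one h0 h1
  have hderiv : ∀ s ∈ uIcc 0 b, HasDerivAt (fun s : ℝ => y ^ s / Real.log y) (y ^ s) s := by
    intro s _
    have := ((hasDerivAt_id s).const_rpow h0).div_const (Real.log y)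
    simpa [hlog] using this
  rw [intervalIntegral.integral_eq_sub_of_hasDerivAt hderiv]
  · simp [sub_div]
  · exact (continuous_const.rpow continuous_id fun _ => Or.inl h0.ne').intervalIntegrable _ _

lemma one_sub_pow_mul_eq {y : ℝ} (hy : y ∈ Ioc (0 : ℝ) 1) (n : ℕ) :
    (1 - y ^ n) * (1 / (1 - y) + 1 / Real.log y)
      = ∑ i ∈ Finset.range n, y ^ i - ∫ s in (0 : ℝ)..n, y ^ s := by
  obtain ⟨h0, h1⟩ := hy
  rcases h1.eq_or_lt with rfl | h1
  · simp
  rw [integral_const_rpow_eq h0 h1.ne, geom_sum_eq h1.ne, Real.rpow_natCast]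
  have := (Real.log_neg h0 h1).ne
  have : 1 - y ≠ 0 := by linarith
  have : y - 1 ≠ 0 := by linarith
  field_simp
  ring

lemma integrable_rpow_prod (b : ℝ) :
    Integrable (Function.uncurry fun y s : ℝ => y ^ s)
      ((volume.restrict (Ioc 0 1)).prod (volume.restrict (Ioc 0 b))) := by
  rw [Measure.prod_restrict]
  refine Measure.integrableOn_of_bounded (M := 1) ?_ ?_ ?_
  · simp [Measure.prod_prod]
  · exact (measurable_fst.pow measurable_snd).aestronglyMeasurable
  · refine (ae_restrict_iff' (measurableSet_Ioc.prod measurableSet_Ioc)).2 (ae_of_all _ ?_)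
    rintro ⟨y, s⟩ ⟨hy, hs⟩
    simp only [Function.uncurry, Real.norm_eq_abs]
    rw [abs_of_nonneg (Real.rpow_nonneg hy.1.le _)]
    exact Real.rpow_le_one hy.1.le hy.2 hs.1.le

lemma integral_integral_rpow (b : ℝ) (hb : 0 ≤ b) :
    ∫ y in (0 : ℝ)..1, ∫ s in (0 : ℝ)..b, y ^ s = Real.log (b + 1) := by
  have hint := integrable_rpow_prod b
  have hinner : ∀ s ∈ uIcc 0 b, ∫ y in (0 : ℝ)..1, y ^ s = (s + 1)⁻¹ := by
    intro s hs
    rw [uIcc_of_le hb] at hs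
    rw [integral_rpow (Or.inl (by linarith [hs.1])), Real.one_rpow,
      Real.zero_rpow (by linarith [hs.1]), sub_zero, one_div]
  calc ∫ y in (0 : ℝ)..1, ∫ s in (0 : ℝ)..b, y ^ s
      = ∫ s in (0 : ℝ)..b, ∫ y in (0 : ℝ)..1, y ^ s := by
        simp only [intervalIntegral.integral_of_le hb, intervalIntegral.integral_of_le zero_le_one]
        exact integral_integral_swap hint
    _ = ∫ s in (0 : ℝ)..b, (s + 1)⁻¹ := intervalIntegral.integral_congr hinner
    _ = Real.log (b + 1) := by
        rw [intervalIntegral.integral_comp_add_right (fun s => s⁻¹),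
          integral_inv_of_pos (by norm_num) (by linarith)]
        simp

lemma integral_one_sub_pow_mul (n : ℕ) :
    ∫ y in (0 : ℝ)..1, (1 - y ^ n) * (1 / (1 - y) + 1 / Real.log y)
      = Real.eulerMascheroniSeq n := by
  have hn : (0 : ℝ) ≤ n := n.cast_nonneg
  have hI : IntervalIntegrable (fun y : ℝ => ∫ s in (0 : ℝ)..n, y ^ s) volume 0 1 := by
    rw [intervalIntegrable_iff_integrableOn_Ioc_of_le zero_le_one]
    simp only [intervalIntegral.integral_of_le hn]
    exact (integrable_rpow_prod n).integral_prod_left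
  have hcongr : ∫ y in (0 : ℝ)..1, (1 - y ^ n) * (1 / (1 - y) + 1 / Real.log y)
      = ∫ y in (0 : ℝ)..1, (∑ i ∈ Finset.range n, y ^ i - ∫ s in (0 : ℝ)..n, y ^ s) := by
    refine intervalIntegral.integral_congr_ae (ae_of_all _ fun y hy => ?_)
    exact one_sub_pow_mul_eq (by rwa [uIoc_of_le zero_le_one] at hy) n
  rw [hcongr, intervalIntegral.integral_sub (Continuous.intervalIntegrable (by fun_prop) _ _) hI,
    integral_integral_rpow n hn, intervalIntegral.integral_finsetSum
      fun i _ => Continuous.intervalIntegrable (by fun_prop) _ _]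
  simp [Real.eulerMascheroniSeq, harmonic]

lemma intervalIntegrable_one_div_one_sub_add_one_div_log :
    IntervalIntegrable (fun y : ℝ => 1 / (1 - y) + 1 / Real.log y) volume 0 1 := by
  rw [intervalIntegrable_iff_integrableOn_Ioc_of_le zero_le_one]
  refine Measure.integrableOn_of_bounded (M := 1) (by simp) ?_ ?_
  · exact Measurable.aestronglyMeasurable (by fun_prop)
  · refine (ae_restrict_iff' measurableSet_Ioc).2 (ae_of_all _ fun y hy => ?_)
    obtain ⟨h0, h1⟩ := one_div_one_sub_add_one_div_log_mem_Icc hy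
    rwa [Real.norm_eq_abs, abs_of_nonneg h0]

lemma integral_one_div_one_sub_add_one_div_log :
    ∫ y in (0 : ℝ)..1, (1 / (1 - y) + 1 / Real.log y) = Real.eulerMascheroniConstant := by
  refine tendsto_nhds_unique ?_ Real.tendsto_eulerMascheroniSeq
  rw [← funext integral_one_sub_pow_mul]
  refine intervalIntegral.tendsto_integral_filter_of_dominated_convergence (fun _ => 1)
    (Eventually.of_forall fun n => Measurable.aestronglyMeasurable (by fun_prop))
    (Eventually.of_forall fun n => ae_of_all _ fun y hy => ?_) (by simp)
    (ae_of_all _ fun y hy => ?_)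
  all_goals rw [uIoc_of_le zero_le_one] at hy
  · obtain ⟨h0, h1⟩ := one_div_one_sub_add_one_div_log_mem_Icc hy
    have hp0 : 0 ≤ y ^ n := pow_nonneg hy.1.le n
    have hp1 : y ^ n ≤ 1 := pow_le_one₀ hy.1.le hy.2
    rw [Real.norm_eq_abs, abs_of_nonneg (mul_nonneg (by linarith) h0)]
    exact mul_le_one₀ (by linarith) h0 h1
  · rcases hy.2.eq_or_lt with rfl | hlt
    · simp
    · simpa using ((tendsto_pow_atTop_nhds_zero_of_lt_one hy.1.le hlt).const_sub 1).mul_const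
        (1 / (1 - y) + 1 / Real.log y)

/-- The integral `∫_0^1 (1/x + 1/log(1-x)) dx` converges and equals the
Euler–Mascheroni constant `γ`. -/
theorem integral_eq_eulerMascheroni :
    IntervalIntegrable (fun x : ℝ => 1 / x + 1 / Real.log (1 - x)) volume 0 1 ∧
    ∫ x in (0 : ℝ)..1, (1 / x + 1 / Real.log (1 - x))
      = Real.eulerMascheroniConstant := by
  constructor
  · have h := (intervalIntegrable_one_div_one_sub_add_one_div_log.comp_sub_left 1).symm
    simpa using h
  · have h := intervalIntegral.integral_comp_sub_left
      (fun y : ℝ => 1 / (1 - y) + 1 / Real.log y) (a := 0) (b := 1) 1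
    simp only [sub_sub_cancel, sub_self, sub_zero] at h
    rw [h, integral_one_div_one_sub_add_one_div_log]
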